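/- For every integer g ≥ 2 and every τ ∈ ℍ_g: (2^{2g} − 1)·S_{0,16}^g(τ) = 6·S_{1,8}^g(τ) + 24·S_{2,4}^g(τ). -/

import Mathlib

open scoped BigOperators

noncomputable section

/-- The Siegel upper half-space: symmetric complex matrices with positive
definite imaginary part (indexed by a finite type `ι`). -/
def Siegel (ι : Type) [Fintype ι] : Set (Matrix ι ι ℂ) :=
  {τ | τ.IsSymm ∧ ∀ v : ι → ℝ, v ≠ 0 → 0 < ∑ i, ∑ j, v i * (τ i j).im * v j}

/-- The theta function with characteristic `[ε, δ]`. -/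
def theta {ι : Type} [Fintype ι] (ε δ : ι → ZMod 2) (τ : Matrix ι ι ℂ) (z : ι → ℂ) : ℂ :=
  ∑' n : ι → ℤ, Complex.exp ((Real.pi : ℂ) * Complex.I *
    ((∑ i, ∑ j, ((n i : ℂ) + ((ε i).val : ℂ) / 2) * τ i j * ((n j : ℂ) + ((ε j).val : ℂ) / 2)) +
     2 * ∑ i, ((n i : ℂ) + ((ε i).val : ℂ) / 2) * (z i + ((δ i).val : ℂ) / 2)))

/-- A theta characteristic, an element of `𝔽₂^{2g}`. -/
abbrev Char2 (ι : Type) := (ι → ZMod 2) × (ι → ZMod 2)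

/-- Theta function, with the characteristic as a pair. -/
def thetaChar {ι : Type} [Fintype ι] (m : Char2 ι) (τ : Matrix ι ι ℂ) (z : ι → ℂ) : ℂ :=
  theta m.1 m.2 τ z

/-- Theta constant. -/
def thetaConst {ι : Type} [Fintype ι] (m : Char2 ι) (τ : Matrix ι ι ℂ) : ℂ :=
  thetaChar m τ 0

/-- `W` is (the underlying finite set of) an `i`-dimensional affine subspace of `𝔽₂^{2g}`,
i.e. a coset of an `i`-dimensional linear subspace. -/
def IsAffineCosetDim {ι : Type} [Fintype ι] (i : ℕ) (W : Finset (Char2 ι)) : Prop :=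
  ∃ (V : Submodule (ZMod 2) (Char2 ι)) (x : Char2 ι),
    Module.finrank (ZMod 2) V = i ∧ (W : Set (Char2 ι)) = (fun v => x + v) '' (V : Set (Char2 ι))

/-- The modular form `S_{i,s}^g(τ) = Σ_W (Π_{w∈W} θ_w(τ))^s`, the sum over all
`i`-dimensional affine subspaces `W` of `𝔽₂^{2g}`, each counted once. -/
noncomputable def Sform (ι : Type) [Fintype ι] (i s : ℕ) (τ : Matrix ι ι ℂ) : ℂ :=
  letI := Classical.propDecidable
  ∑ W ∈ Finset.univ.filter (fun W : Finset (Char2 ι) => IsAffineCosetDim i W),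
    (∏ w ∈ W, thetaConst w τ) ^ s

/-! ### Convergence of the theta series -/

theorem summable_pi_prod_of_nonneg {ι κ : Type*} [Fintype ι] {f : ι → κ → ℝ}
    (hf : ∀ i k, 0 ≤ f i k) (hs : ∀ i, Summable (f i)) :
    Summable fun n : ι → κ => ∏ i, f i (n i) := by
  classical
  refine summable_of_sum_le (c := ∏ i, ∑' k, f i k)
    (fun n => Finset.prod_nonneg fun i _ => hf i _) fun s => ?_
  calc ∑ n ∈ s, ∏ i, f i (n i)
      ≤ ∑ n ∈ Fintype.piFinset fun i => s.image fun n => n i, ∏ i, f i (n i) :=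
        Finset.sum_le_sum_of_subset_of_nonneg
          (fun n hn => Fintype.mem_piFinset.2 fun i => Finset.mem_image_of_mem _ hn)
          fun n _ _ => Finset.prod_nonneg fun i _ => hf i _
    _ = ∏ i, ∑ k ∈ s.image fun n => n i, f i k := (Finset.prod_univ_sum _ _).symm
    _ ≤ ∏ i, ∑' k, f i k :=
        Finset.prod_le_prod (fun i _ => Finset.sum_nonneg fun k _ => hf i k)
          fun i _ => (hs i).sum_le_tsum _ fun k _ => hf i k

theorem summable_exp_neg_mul_int_add_sq {c : ℝ} (hc : 0 < c) (r : ℝ) :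
    Summable fun n : ℤ => Real.exp (-(c * ((n : ℝ) + r) ^ 2)) := by
  have hpi := Real.pi_pos
  have h := ((summable_jacobiTheta₂_term_iff (((c * r / Real.pi : ℝ) : ℂ) * Complex.I)
    (((c / Real.pi : ℝ) : ℂ) * Complex.I)).2 (by
      rw [Complex.mul_I_im, Complex.ofReal_re]; positivity)).norm
  refine (h.mul_left (Real.exp (-(c * r ^ 2)))).congr fun n => ?_
  rw [norm_jacobiTheta₂_term, ← Real.exp_add, Complex.mul_I_im, Complex.mul_I_im,
    Complex.ofReal_re, Complex.ofReal_re]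
  congr 1
  field_simp
  ring

theorem exists_pos_mul_sum_sq_le {ι : Type} [Fintype ι] {τ : Matrix ι ι ℂ} (hτ : τ ∈ Siegel ι) :
    ∃ κ : ℝ, 0 < κ ∧ ∀ v : ι → ℝ,
      κ * ∑ i, v i ^ 2 ≤ ∑ i, ∑ j, v i * (τ i j).im * v j := by
  let S : Set (ι → ℝ) := {v | ∑ i, v i ^ 2 = 1}
  have hcont : Continuous fun v : ι → ℝ => ∑ i, ∑ j, v i * (τ i j).im * v j := by fun_prop
  have hS : IsCompact S := by
    refine Metric.isCompact_of_isClosed_isBounded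
      (isClosed_eq (by fun_prop) continuous_const) ?_
    refine (Metric.isBounded_closedBall (x := (0 : ι → ℝ)) (r := 1)).subset fun v hv => ?_
    rw [mem_closedBall_zero_iff, pi_norm_le_iff_of_nonneg zero_le_one]
    intro i
    rw [Real.norm_eq_abs, ← sq_le_one_iff_abs_le_one]
    exact (Finset.single_le_sum (f := fun i => v i ^ 2) (fun i _ => sq_nonneg _)
      (Finset.mem_univ i)).trans_eq hv
  have hmin : ∃ κ : ℝ, 0 < κ ∧ ∀ v ∈ S, κ ≤ ∑ i, ∑ j, v i * (τ i j).im * v j := by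
    rcases S.eq_empty_or_nonempty with h | h
    · exact ⟨1, one_pos, by simp [h]⟩
    · obtain ⟨w, hw, hmin⟩ := hS.exists_isMinOn h hcont.continuousOn
      refine ⟨_, hτ.2 w ?_, fun v hv => hmin hv⟩
      rintro rfl
      simp [S] at hw
  obtain ⟨κ, hκ, h⟩ := hmin
  refine ⟨κ, hκ, fun v => ?_⟩
  rcases (Finset.sum_nonneg fun i _ => sq_nonneg (v i) :
    0 ≤ ∑ i, v i ^ 2).eq_or_lt with h0 | h0
  · have hv : v = 0 := funext fun i => by
      simpa using (Finset.sum_eq_zero_iff_of_nonneg fun i _ => sq_nonneg (v i)).1 h0.symm i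
    simp [hv]
  · set N := ∑ i, v i ^ 2 with hN
    have hsq : Real.sqrt N ^ 2 = N := Real.sq_sqrt h0.le
    have hpos : 0 < Real.sqrt N := Real.sqrt_pos.2 h0
    have h1 := h (fun i => (Real.sqrt N)⁻¹ * v i) (by
      change ∑ i, ((Real.sqrt N)⁻¹ * v i) ^ 2 = 1
      simp_rw [mul_pow, ← Finset.mul_sum, ← hN, inv_pow, hsq]
      exact inv_mul_cancel₀ h0.ne')
    have h2 : ∑ i, ∑ j, ((Real.sqrt N)⁻¹ * v i) * (τ i j).im * ((Real.sqrt N)⁻¹ * v j) =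
        N⁻¹ * ∑ i, ∑ j, v i * (τ i j).im * v j := by
      simp_rw [Finset.mul_sum]
      refine Finset.sum_congr rfl fun i _ => Finset.sum_congr rfl fun j _ => ?_
      rw [← hsq, Real.sqrt_sq hpos.le, ← inv_pow]
      ring
    rw [h2, le_inv_mul_iff₀ h0] at h1
    linarith

/-- The quadratic form `p ↦ pᵀ τ p`. -/
def quadForm {ι : Type} [Fintype ι] (τ : Matrix ι ι ℂ) (p : ι → ℂ) : ℂ :=
  ∑ i, ∑ j, p i * τ i j * p j

theorem quadForm_add_add_quadForm_sub {ι : Type} [Fintype ι] (τ : Matrix ι ι ℂ) (u v : ι → ℂ) :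
    quadForm τ (u + v) + quadForm τ (u - v) = 2 * quadForm τ u + 2 * quadForm τ v := by
  simp only [quadForm, Finset.mul_sum, ← Finset.sum_add_distrib, Pi.add_apply, Pi.sub_apply]
  exact Finset.sum_congr rfl fun i _ => Finset.sum_congr rfl fun j _ => by ring

theorem quadForm_ofReal_im {ι : Type} [Fintype ι] (τ : Matrix ι ι ℂ) (v : ι → ℝ) :
    (quadForm τ fun i => (v i : ℂ)).im = ∑ i, ∑ j, v i * (τ i j).im * v j := by
  simp [quadForm, Complex.im_sum]

theorem norm_cexp_pi_I_mul (w : ℂ) :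
    ‖Complex.exp (Real.pi * Complex.I * w)‖ = Real.exp (-(Real.pi * w.im)) := by
  rw [Complex.norm_exp, mul_assoc, Complex.re_ofReal_mul, Complex.I_mul_re]
  simp

theorem summable_norm_cexp_quadForm {ι : Type} [Fintype ι] {τ : Matrix ι ι ℂ}
    (hτ : τ ∈ Siegel ι) {c : ℝ} (hc : 0 < c) (r : ι → ℝ) :
    Summable fun n : ι → ℤ => ‖Complex.exp (Real.pi * Complex.I *
      (c * quadForm τ fun i => (n i : ℂ) + (r i : ℂ)))‖ := by
  obtain ⟨κ, hκ, hle⟩ := exists_pos_mul_sum_sq_le hτ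
  have hpi := Real.pi_pos
  refine Summable.of_nonneg_of_le (fun _ => norm_nonneg _) (fun n => ?_)
    (summable_pi_prod_of_nonneg (fun i k => (Real.exp_pos _).le)
      fun i => summable_exp_neg_mul_int_add_sq (c := Real.pi * c * κ) (by positivity) (r i))
  have hv := hle fun i => (n i : ℝ) + r i
  rw [← quadForm_ofReal_im] at hv
  push_cast at hv
  rw [norm_cexp_pi_I_mul, Complex.im_ofReal_mul, ← Real.exp_sum, Real.exp_le_exp,
    Finset.sum_neg_distrib, neg_le_neg_iff, ← Finset.mul_sum, mul_assoc, mul_assoc]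
  gcongr

/-! ### Signs and orthogonality over `𝔽₂` -/

/-- The nontrivial character of `𝔽₂`. -/
def zsign (x : ZMod 2) : ℂ := (-1) ^ x.val

@[simp]
theorem zsign_zero : zsign 0 = 1 := by simp [zsign]

@[simp]
theorem zsign_one : zsign 1 = -1 := by simp [zsign, ZMod.val_one]

theorem zmod_two_eq_zero_or_one (x : ZMod 2) : x = 0 ∨ x = 1 := by
  revert x; decide

theorem zsign_add (x y : ZMod 2) : zsign (x + y) = zsign x * zsign y := by
  rcases zmod_two_eq_zero_or_one x with rfl | rfl <;>
    rcases zmod_two_eq_zero_or_one y with rfl | rfl <;>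
    simp [CharTwo.add_self_eq_zero]

theorem zsign_intCast (n : ℤ) : zsign (n : ZMod 2) = (-1) ^ n := by
  rcases Int.even_or_odd n with h | h
  · rw [h.neg_one_zpow, (ZMod.intCast_zmod_eq_zero_iff_dvd n 2).2 h.two_dvd, zsign_zero]
  · rw [h.neg_one_zpow, ZMod.intCast_eq_one_iff_odd.2 h, zsign_one]

theorem zsign_sum {α : Type*} (s : Finset α) (f : α → ZMod 2) :
    zsign (∑ i ∈ s, f i) = ∏ i ∈ s, zsign (f i) := by
  classical
  induction s using Finset.induction_on with
  | empty => simp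
  | insert a s ha ih => rw [Finset.sum_insert ha, Finset.prod_insert ha, zsign_add, ih]

theorem sum_zsign_dotProduct {ι : Type} [Fintype ι] [DecidableEq ι] (x : ι → ZMod 2) :
    ∑ d : ι → ZMod 2, zsign (d ⬝ᵥ x) = if x = 0 then 2 ^ Fintype.card ι else 0 := by
  have hfac (y : ZMod 2) : ∑ t : ZMod 2, zsign (t * y) = if y = 0 then 2 else 0 := by
    rw [show ∑ t : ZMod 2, zsign (t * y) = zsign (0 * y) + zsign (1 * y) from
      Fin.sum_univ_two fun t : ZMod 2 => zsign (t * y)]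
    rcases zmod_two_eq_zero_or_one y with rfl | rfl
    · norm_num
    · simp
  have hprod := Finset.prod_univ_sum (fun _ : ι => (Finset.univ : Finset (ZMod 2)))
    fun i t => zsign (t * x i)
  rw [Fintype.piFinset_univ] at hprod
  simp_rw [dotProduct, zsign_sum, ← hprod, hfac]
  split_ifs with h
  · simp [h]
  · obtain ⟨i, hi⟩ := Function.ne_iff.1 h
    exact Finset.prod_eq_zero (Finset.mem_univ i) (if_neg hi)

/-! ### The addition formula -/

/-- For a class `e` mod 2, pairs of integers `(n, m)` correspond to triples `(s, a, b)` with
`n + m + e = 2 a + s` and `n - m = 2 b + (s + e)`, residues being represented by `0` or `1`. -/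
def halfSumEquiv (e : ZMod 2) : ZMod 2 × ℤ × ℤ ≃ ℤ × ℤ where
  toFun t := (t.2.1 + t.2.2 + ((t.1.val : ℤ) + ((t.1 + e).val : ℤ) - e.val) / 2,
    t.2.1 - t.2.2 + ((t.1.val : ℤ) - ((t.1 + e).val : ℤ) - e.val) / 2)
  invFun p := (((p.1 + p.2 : ℤ) : ZMod 2) + e,
    (p.1 + p.2 + e.val - ((((p.1 + p.2 : ℤ) : ZMod 2) + e).val : ℤ)) / 2,
    (p.1 - p.2 - (((p.1 + p.2 : ℤ) : ZMod 2).val : ℤ)) / 2)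
  left_inv := by
    rintro ⟨s, a, b⟩
    have h2 : (2 : ZMod 2) = 0 := rfl
    have h11 : (1 + 1 : ZMod 2) = 0 := rfl
    rcases zmod_two_eq_zero_or_one s with rfl | rfl <;>
      rcases zmod_two_eq_zero_or_one e with rfl | rfl <;>
      ring_nf <;> simp [h2, h11, ZMod.val_one]
  right_inv := by
    rintro ⟨n, m⟩
    have h11 : (1 + 1 : ZMod 2) = 0 := rfl
    rcases Int.even_or_odd (n + m) with h | h
    · have h' := (ZMod.intCast_zmod_eq_zero_iff_dvd (n + m) 2).2 h.two_dvd
      obtain ⟨k, hk⟩ := h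
      rcases zmod_two_eq_zero_or_one e with rfl | rfl <;>
        simp only [h', h11, ZMod.val_one, ZMod.val_zero, Prod.mk.injEq, zero_add, add_zero] <;>
        constructor <;> push_cast <;> omega
    · have h' := ZMod.intCast_eq_one_iff_odd.2 h
      obtain ⟨k, hk⟩ := h
      rcases zmod_two_eq_zero_or_one e with rfl | rfl <;>
        simp only [h', h11, ZMod.val_one, ZMod.val_zero, Prod.mk.injEq, zero_add, add_zero] <;>
        constructor <;> push_cast <;> omega

theorem halfSumEquiv_fst (e s : ZMod 2) (a b : ℤ) :
    ((halfSumEquiv e (s, a, b)).1 : ℂ) + (e.val : ℂ) / 2 =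
      ((a : ℂ) + (s.val : ℂ) / 2) + ((b : ℂ) + ((s + e).val : ℂ) / 2) := by
  have h11 : (1 + 1 : ZMod 2) = 0 := rfl
  rcases zmod_two_eq_zero_or_one s with rfl | rfl <;>
    rcases zmod_two_eq_zero_or_one e with rfl | rfl <;>
    simp [halfSumEquiv, h11, ZMod.val_one, -ZMod.natCast_val] <;> ring

theorem halfSumEquiv_snd (e s : ZMod 2) (a b : ℤ) :
    ((halfSumEquiv e (s, a, b)).2 : ℂ) + (e.val : ℂ) / 2 =
      ((a : ℂ) + (s.val : ℂ) / 2) - ((b : ℂ) + ((s + e).val : ℂ) / 2) := by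
  have h11 : (1 + 1 : ZMod 2) = 0 := rfl
  rcases zmod_two_eq_zero_or_one s with rfl | rfl <;>
    rcases zmod_two_eq_zero_or_one e with rfl | rfl <;>
    simp [halfSumEquiv, h11, ZMod.val_one, -ZMod.natCast_val] <;> ring

/-- The coordinatewise version of `halfSumEquiv`. -/
def halfSumPiEquiv {ι : Type} (ε : ι → ZMod 2) :
    (ι → ZMod 2) × (ι → ℤ) × (ι → ℤ) ≃ (ι → ℤ) × (ι → ℤ) where
  toFun t := (fun i => (halfSumEquiv (ε i) (t.1 i, t.2.1 i, t.2.2 i)).1,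
    fun i => (halfSumEquiv (ε i) (t.1 i, t.2.1 i, t.2.2 i)).2)
  invFun p := (fun i => ((halfSumEquiv (ε i)).symm (p.1 i, p.2 i)).1,
    fun i => ((halfSumEquiv (ε i)).symm (p.1 i, p.2 i)).2.1,
    fun i => ((halfSumEquiv (ε i)).symm (p.1 i, p.2 i)).2.2)
  left_inv t := by simp
  right_inv p := by simp

/-- The vector `n + ε / 2`, with the residues represented by `0` or `1`. -/
def shiftVec {ι : Type} (n : ι → ℤ) (ε : ι → ZMod 2) : ι → ℂ :=
  fun i => (n i : ℂ) + ((ε i).val : ℂ) / 2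

/-- The second order theta constant with characteristic `σ`. -/
def secondOrderTheta {ι : Type} [Fintype ι] (τ : Matrix ι ι ℂ) (σ : ι → ZMod 2) : ℂ :=
  ∑' n : ι → ℤ, Complex.exp (Real.pi * Complex.I * (2 * quadForm τ (shiftVec n σ)))

theorem thetaConst_eq_tsum {ι : Type} [Fintype ι] (τ : Matrix ι ι ℂ) (m : Char2 ι) :
    thetaConst m τ = ∑' n : ι → ℤ, Complex.exp (Real.pi * Complex.I *
      (quadForm τ (shiftVec n m.1) + ∑ i, shiftVec n m.1 i * ((m.2 i).val : ℂ))) := by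
  simp only [thetaConst, thetaChar, theta, quadForm, shiftVec, Pi.zero_apply, zero_add]
  refine tsum_congr fun n => ?_
  congr 3
  rw [Finset.mul_sum]
  exact Finset.sum_congr rfl fun i _ => by ring

theorem summable_norm_cexp_shiftVec {ι : Type} [Fintype ι] {τ : Matrix ι ι ℂ}
    (hτ : τ ∈ Siegel ι) {c : ℝ} (hc : 0 < c) (σ : ι → ZMod 2) :
    Summable fun n : ι → ℤ =>
      ‖Complex.exp (Real.pi * Complex.I * (c * quadForm τ (shiftVec n σ)))‖ := by
  refine (summable_norm_cexp_quadForm hτ hc fun i => ((σ i).val : ℝ) / 2).congr fun n => ?_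
  simp only [Complex.ofReal_div, Complex.ofReal_natCast, Complex.ofReal_ofNat]
  rfl

theorem summable_norm_theta_term {ι : Type} [Fintype ι] {τ : Matrix ι ι ℂ}
    (hτ : τ ∈ Siegel ι) (m : Char2 ι) :
    Summable fun n : ι → ℤ => ‖Complex.exp (Real.pi * Complex.I *
      (quadForm τ (shiftVec n m.1) + ∑ i, shiftVec n m.1 i * ((m.2 i).val : ℂ)))‖ := by
  refine (summable_norm_cexp_shiftVec hτ one_pos m.1).congr fun n => ?_
  have h : (∑ i, shiftVec n m.1 i * ((m.2 i).val : ℂ)).im = 0 := by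
    rw [Complex.im_sum]
    refine Finset.sum_eq_zero fun i _ => ?_
    rw [shiftVec, show ((n i : ℂ) + ((m.1 i).val : ℂ) / 2) * ((m.2 i).val : ℂ) =
      (((n i : ℝ) + ((m.1 i).val : ℝ) / 2) * ((m.2 i).val : ℝ) : ℝ) by push_cast; rfl,
      Complex.ofReal_im]
  rw [norm_cexp_pi_I_mul, norm_cexp_pi_I_mul, Complex.add_im, h, Complex.ofReal_one, one_mul,
    add_zero]

theorem cexp_pi_I_mul_sum {ι : Type} [Fintype ι] (a : ι → ℤ) (σ δ : ι → ZMod 2) :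
    Complex.exp (Real.pi * Complex.I * (2 * ∑ i, shiftVec a σ i * ((δ i).val : ℂ))) =
      zsign (δ ⬝ᵥ σ) := by
  rw [dotProduct, zsign_sum, Finset.mul_sum, Finset.mul_sum, Complex.exp_sum]
  refine Finset.prod_congr rfl fun i _ => ?_
  have hcast : δ i * σ i = (((2 * a i + (σ i).val) * (δ i).val : ℤ) : ZMod 2) := by
    have h2 : (2 : ZMod 2) = 0 := rfl
    push_cast
    rw [ZMod.natCast_zmod_val, ZMod.natCast_zmod_val, h2]
    ring
  rw [hcast, zsign_intCast, ← Complex.exp_pi_mul_I, ← Complex.exp_int_mul]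
  congr 1
  simp only [shiftVec]
  push_cast
  ring

theorem thetaConst_sq {ι : Type} [Fintype ι] [DecidableEq ι] {τ : Matrix ι ι ℂ} (hτ : τ ∈ Siegel ι)
    (m : Char2 ι) :
    thetaConst m τ ^ 2 = ∑ σ : ι → ZMod 2,
      zsign (m.2 ⬝ᵥ σ) * (secondOrderTheta τ σ * secondOrderTheta τ (σ + m.1)) := by
  obtain ⟨ε, δ⟩ := m
  have hθ := summable_norm_theta_term hτ (ε, δ)
  have hΘ (σ : ι → ZMod 2) := summable_norm_cexp_shiftVec hτ two_pos σ
  simp only [Complex.ofReal_ofNat] at hΘ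
  have hsum := summable_mul_of_summable_norm hθ hθ
  rw [← (halfSumPiEquiv ε).summable_iff] at hsum
  rw [sq, thetaConst_eq_tsum, tsum_mul_tsum_of_summable_norm hθ hθ,
    ← (halfSumPiEquiv ε).tsum_eq]
  refine hsum.tsum_prod.trans ?_
  rw [tsum_fintype]
  refine Finset.sum_congr rfl fun σ _ => ?_
  rw [secondOrderTheta, secondOrderTheta, tsum_mul_tsum_of_summable_norm (hΘ _) (hΘ _),
    ← tsum_mul_left]
  refine tsum_congr fun t => ?_
  obtain ⟨a, b⟩ := t
  have h1 : shiftVec (halfSumPiEquiv ε (σ, a, b)).1 ε = shiftVec a σ + shiftVec b (σ + ε) :=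
    funext fun i => halfSumEquiv_fst (ε i) (σ i) (a i) (b i)
  have h2 : shiftVec (halfSumPiEquiv ε (σ, a, b)).2 ε = shiftVec a σ - shiftVec b (σ + ε) :=
    funext fun i => halfSumEquiv_snd (ε i) (σ i) (a i) (b i)
  simp only [Function.comp_apply]
  rw [h1, h2, ← cexp_pi_I_mul_sum a σ δ, ← Complex.exp_add, ← Complex.exp_add, ← Complex.exp_add]
  congr 1
  have h3 := quadForm_add_add_quadForm_sub τ (shiftVec a σ) (shiftVec b (σ + ε))
  have h4 : ∑ i, (shiftVec a σ + shiftVec b (σ + ε)) i * ((δ i).val : ℂ) +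
      ∑ i, (shiftVec a σ - shiftVec b (σ + ε)) i * ((δ i).val : ℂ) =
      2 * ∑ i, shiftVec a σ i * ((δ i).val : ℂ) := by
    rw [← Finset.sum_add_distrib, Finset.mul_sum]
    exact Finset.sum_congr rfl fun i _ => by simp only [Pi.add_apply, Pi.sub_apply]; ring
  linear_combination (Real.pi * Complex.I) * (h3 + h4)

/-! ### Riemann's quartic relations -/

/-- The symplectic form on `𝔽₂^{2g}`. -/
def sympForm {ι : Type} [Fintype ι] (m a : Char2 ι) : ZMod 2 :=
  m.1 ⬝ᵥ a.2 + m.2 ⬝ᵥ a.1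

theorem sympForm_add_right {ι : Type} [Fintype ι] (m a b : Char2 ι) :
    sympForm m (a + b) = sympForm m a + sympForm m b := by
  simp only [sympForm, Prod.fst_add, Prod.snd_add, dotProduct_add]
  abel

theorem sum_zsign_sympForm {ι : Type} [Fintype ι] [DecidableEq ι] (x : Char2 ι) :
    ∑ m : Char2 ι, zsign (sympForm m x) = if x = 0 then 2 ^ (2 * Fintype.card ι) else 0 := by
  simp_rw [sympForm, zsign_add]
  rw [Fintype.sum_prod_type]
  simp_rw [← Finset.mul_sum, ← Finset.sum_mul, sum_zsign_dotProduct, Prod.ext_iff, Prod.fst_zero,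
    Prod.snd_zero]
  by_cases h1 : x.1 = 0 <;> by_cases h2 : x.2 = 0 <;> simp [h1, h2, two_mul, pow_add]

theorem char_two_add_eq_zero_iff {A : Type*} [AddCommGroup A] [Module (ZMod 2) A] (a b : A) :
    a + b = 0 ↔ b = a := by
  rw [add_eq_zero_iff_eq_neg, ZModModule.neg_eq_self, eq_comm]

theorem sum_zsign_mul_sq_sum {ι : Type} [Fintype ι] [DecidableEq ι] (X : (ι → ZMod 2) → ℂ)
    (m : Char2 ι) :
    ∑ a : Char2 ι, zsign (sympForm m a) *
        (∑ σ : ι → ZMod 2, zsign (a.2 ⬝ᵥ σ) * (X σ * X (σ + a.1))) ^ 2 =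
      2 ^ Fintype.card ι *
        (∑ σ : ι → ZMod 2, zsign (m.2 ⬝ᵥ σ) * (X σ * X (σ + m.1))) ^ 2 := by
  obtain ⟨ε, δ⟩ := m
  have hleft (e : ι → ZMod 2) : ∑ d : ι → ZMod 2, zsign (sympForm (ε, δ) (e, d)) *
      (∑ σ : ι → ZMod 2, zsign (d ⬝ᵥ σ) * (X σ * X (σ + e))) ^ 2 =
      2 ^ Fintype.card ι * ∑ σ : ι → ZMod 2,
        zsign (δ ⬝ᵥ e) * (X σ * X (σ + e) * (X (σ + ε) * X (σ + ε + e))) := by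
    calc _ = ∑ d : ι → ZMod 2, ∑ σ : ι → ZMod 2, ∑ ρ : ι → ZMod 2,
          zsign (d ⬝ᵥ (σ + ε + ρ)) *
            (zsign (δ ⬝ᵥ e) * (X σ * X (σ + e) * (X ρ * X (ρ + e)))) := by
          refine Finset.sum_congr rfl fun d _ => ?_
          rw [sq, Finset.sum_mul_sum, Finset.mul_sum]
          refine Finset.sum_congr rfl fun σ _ => ?_
          rw [Finset.mul_sum]
          refine Finset.sum_congr rfl fun ρ _ => ?_
          rw [sympForm, dotProduct_add, dotProduct_add, zsign_add, zsign_add, zsign_add,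
            dotProduct_comm ε d]
          ring
      _ = ∑ σ : ι → ZMod 2, ∑ ρ : ι → ZMod 2, (if ρ = σ + ε then 2 ^ Fintype.card ι else 0) *
            (zsign (δ ⬝ᵥ e) * (X σ * X (σ + e) * (X ρ * X (ρ + e)))) := by
          rw [Finset.sum_comm]
          refine Finset.sum_congr rfl fun σ _ => ?_
          rw [Finset.sum_comm]
          refine Finset.sum_congr rfl fun ρ _ => ?_
          rw [← Finset.sum_mul, sum_zsign_dotProduct]
          simp only [char_two_add_eq_zero_iff]
      _ = _ := by
          rw [Finset.mul_sum]
          refine Finset.sum_congr rfl fun σ _ => ?_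
          simp
  rw [Fintype.sum_prod_type]
  simp_rw [hleft]
  rw [← Finset.mul_sum, Finset.sum_comm, sq, Finset.sum_mul_sum]
  congr 1
  refine Finset.sum_congr rfl fun σ _ => ?_
  refine Fintype.sum_equiv (Equiv.addLeft σ) _ _ fun e => ?_
  have hs : zsign (δ ⬝ᵥ σ) * zsign (δ ⬝ᵥ σ) = 1 := by
    rw [← zsign_add, CharTwo.add_self_eq_zero, zsign_zero]
  rw [Equiv.coe_addLeft, dotProduct_add, zsign_add, add_right_comm σ ε e]
  linear_combination -(zsign (δ ⬝ᵥ e) * (X σ * X (σ + e) * (X (σ + ε) * X (σ + e + ε)))) * hs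

theorem sum_zsign_mul_thetaConst_pow_four {ι : Type} [Fintype ι] [DecidableEq ι]
    {τ : Matrix ι ι ℂ} (hτ : τ ∈ Siegel ι) (m : Char2 ι) :
    ∑ a : Char2 ι, zsign (sympForm m a) * thetaConst a τ ^ 4 =
      2 ^ Fintype.card ι * thetaConst m τ ^ 4 := by
  have h4 (a : Char2 ι) : thetaConst a τ ^ 4 = (thetaConst a τ ^ 2) ^ 2 := by ring
  simp_rw [h4, thetaConst_sq hτ]
  exact sum_zsign_mul_sq_sum _ m

theorem sum_add_add_of_fourier_eigenvector {ι : Type} [Fintype ι] [DecidableEq ι]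
    {f : Char2 ι → ℂ}
    (hf : ∀ m, ∑ a, zsign (sympForm m a) * f a = 2 ^ Fintype.card ι * f m) :
    ∑ a, ∑ b, ∑ c, f a * f b * f c * f (a + b + c) =
      2 ^ (2 * Fintype.card ι) * ∑ m, f m ^ 4 := by
  have hexp (m : Char2 ι) : (∑ a, zsign (sympForm m a) * f a) ^ 4 =
      ∑ a, ∑ b, ∑ c, ∑ d, zsign (sympForm m (a + b + c + d)) * (f a * f b * f c * f d) := by
    have hterm (a b c d : Char2 ι) :
        zsign (sympForm m (a + b + c + d)) * (f a * f b * f c * f d) =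
          zsign (sympForm m a) * f a * (zsign (sympForm m b) * f b *
            (zsign (sympForm m c) * f c * (zsign (sympForm m d) * f d))) := by
      simp_rw [sympForm_add_right, zsign_add]
      ring
    simp_rw [hterm, ← Finset.mul_sum, ← Finset.sum_mul]
    ring
  have hsum : ∑ m : Char2 ι, (∑ a, zsign (sympForm m a) * f a) ^ 4 =
      2 ^ (2 * Fintype.card ι) * ∑ a, ∑ b, ∑ c, f a * f b * f c * f (a + b + c) := by
    simp_rw [hexp]
    rw [Finset.sum_comm, Finset.mul_sum]
    refine Finset.sum_congr rfl fun a _ => ?_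
    rw [Finset.sum_comm, Finset.mul_sum]
    refine Finset.sum_congr rfl fun b _ => ?_
    rw [Finset.sum_comm, Finset.mul_sum]
    refine Finset.sum_congr rfl fun c _ => ?_
    rw [Finset.sum_comm]
    simp_rw [← Finset.sum_mul, sum_zsign_sympForm, char_two_add_eq_zero_iff]
    simp
  have hpow : (2 : ℂ) ^ (2 * Fintype.card ι) ≠ 0 := pow_ne_zero _ two_ne_zero
  refine mul_left_cancel₀ hpow ?_
  rw [← hsum]
  simp_rw [hf, mul_pow]
  rw [← Finset.mul_sum]
  ring

/-! ### Sums over affine subspaces -/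

theorem isAffineCosetDim_iff {ι : Type} [Fintype ι] (i : ℕ) (W : Finset (Char2 ι)) :
    IsAffineCosetDim i W ↔
      W.card = 2 ^ i ∧ ∀ a ∈ W, ∀ b ∈ W, ∀ c ∈ W, a + b + c ∈ W := by
  classical
  have hcard (V : Submodule (ZMod 2) (Char2 ι)) :
      (V : Set (Char2 ι)).ncard = 2 ^ Module.finrank (ZMod 2) V := by
    have := Module.card_eq_pow_finrank (K := ZMod 2) (V := V)
    rwa [ZMod.card, ← Nat.card_eq_fintype_card] at this
  have hW (V : Submodule (ZMod 2) (Char2 ι)) (x : Char2 ι)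
      (h : (W : Set (Char2 ι)) = (fun v => x + v) '' (V : Set (Char2 ι))) :
      W.card = 2 ^ Module.finrank (ZMod 2) V := by
    rw [← hcard, ← Set.ncard_coe_finset, h, Set.ncard_image_of_injective _ (add_right_injective x)]
  constructor
  · rintro ⟨V, x, rfl, h⟩
    have hmem (a : Char2 ι) : a ∈ W ↔ ∃ v ∈ V, x + v = a := by
      rw [← Finset.mem_coe, h]; rfl
    refine ⟨hW V x h, fun a ha b hb c hc => ?_⟩
    obtain ⟨u, hu, rfl⟩ := (hmem a).1 ha
    obtain ⟨v, hv, rfl⟩ := (hmem b).1 hb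
    obtain ⟨w, hw, rfl⟩ := (hmem c).1 hc
    refine (hmem _).2 ⟨u + v + w, V.add_mem (V.add_mem hu hv) hw, ?_⟩
    have hx : x + x = 0 := ZModModule.add_self x
    linear_combination -hx
  · rintro ⟨hc, hadd⟩
    obtain ⟨x, hx⟩ : W.Nonempty := Finset.card_pos.1 (by rw [hc]; positivity)
    let V : AddSubgroup (Char2 ι) :=
      { carrier := {v | x + v ∈ W}
        zero_mem' := by simpa using hx
        add_mem' := fun {u v} hu hv => by
          have h := hadd _ hu _ hx _ hv
          have hxx : x + x = 0 := ZModModule.add_self x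
          rwa [show x + u + x + (x + v) = x + (u + v) by
            linear_combination hxx] at h
        neg_mem' := fun {v} hv => by
          simpa [ZModModule.neg_eq_self] using hv }
    have h : (W : Set (Char2 ι)) =
        (fun v => x + v) '' (AddSubgroup.toZModSubmodule 2 V : Set (Char2 ι)) := by
      ext a
      constructor
      · intro ha
        refine ⟨x + a, ?_, ?_⟩
        · change x + (x + a) ∈ W
          rwa [← add_assoc, ZModModule.add_self, zero_add]
        · change x + (x + a) = a
          rw [← add_assoc, ZModModule.add_self, zero_add]
      · rintro ⟨v, hv, rfl⟩
        exact hv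
    refine ⟨AddSubgroup.toZModSubmodule 2 V, x, ?_, h⟩
    exact Nat.pow_right_injective le_rfl ((hW _ x h).symm.trans hc)

theorem Sform_eq_sum {ι : Type} [Fintype ι] [DecidableEq ι] (i s : ℕ) (τ : Matrix ι ι ℂ)
    {S : Finset (Finset (Char2 ι))} (hS : ∀ W, W ∈ S ↔ IsAffineCosetDim i W) :
    Sform ι i s τ = ∑ W ∈ S, (∏ w ∈ W, thetaConst w τ) ^ s :=
  Finset.sum_congr (by ext W; simp [hS]) fun _ _ => rfl

theorem Sform_zero {ι : Type} [Fintype ι] [DecidableEq ι] (s : ℕ) (τ : Matrix ι ι ℂ) :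
    Sform ι 0 s τ = ∑ m : Char2 ι, thetaConst m τ ^ s := by
  rw [Sform_eq_sum (S := Finset.univ.map ⟨singleton, Finset.singleton_injective⟩), Finset.sum_map]
  · simp
  · intro W
    rw [isAffineCosetDim_iff, pow_zero, Finset.card_eq_one]
    constructor
    · intro h
      obtain ⟨a, -, rfl⟩ := Finset.mem_map.1 h
      refine ⟨⟨a, rfl⟩, ?_⟩
      simp [ZModModule.add_self]
    · rintro ⟨⟨a, rfl⟩, -⟩
      exact Finset.mem_map.2 ⟨a, Finset.mem_univ a, rfl⟩

theorem two_mul_Sform_one {ι : Type} [Fintype ι] [DecidableEq ι] (s : ℕ) (τ : Matrix ι ι ℂ) :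
    2 * Sform ι 1 s τ =
      (∑ m : Char2 ι, thetaConst m τ ^ s) ^ 2 - ∑ m : Char2 ι, thetaConst m τ ^ (2 * s) := by
  have hoff : ∑ p ∈ (Finset.univ : Finset (Char2 ι)).offDiag,
      (∏ w ∈ ({p.1, p.2} : Finset (Char2 ι)), thetaConst w τ) ^ s = 2 * Sform ι 1 s τ := by
    rw [Sform_eq_sum (S := Finset.univ.filter fun W : Finset (Char2 ι) => W.card = 2),
      Finset.mul_sum, ← Finset.sum_fiberwise_of_maps_to
        (t := Finset.univ.filter fun W : Finset (Char2 ι) => W.card = 2)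
        (g := fun p => ({p.1, p.2} : Finset (Char2 ι)))]
    · refine Finset.sum_congr rfl fun W hW => ?_
      have hW2 : W.card = 2 := (Finset.mem_filter.1 hW).2
      have hfib : (Finset.univ : Finset (Char2 ι)).offDiag.filter
          (fun p => ({p.1, p.2} : Finset (Char2 ι)) = W) = W.offDiag := by
        ext ⟨a, b⟩
        simp only [Finset.mem_filter, Finset.mem_offDiag, Finset.mem_univ, true_and]
        constructor
        · rintro ⟨hab, rfl⟩
          simp [hab]
        · rintro ⟨ha, hb, hab⟩
          refine ⟨hab, Finset.eq_of_subset_of_card_le ?_ ?_⟩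
          · simp [Finset.insert_subset_iff, ha, hb]
          · rw [hW2, Finset.card_pair hab]
      rw [Finset.sum_congr rfl fun p hp => by rw [(Finset.mem_filter.1 hp).2], hfib,
        Finset.sum_const, Finset.offDiag_card, hW2, nsmul_eq_mul]
      norm_num
    · intro p hp
      simpa using Finset.card_pair (Finset.mem_offDiag.1 hp).2.2
    · intro W
      rw [isAffineCosetDim_iff, pow_one, Finset.mem_filter, and_iff_right (Finset.mem_univ W)]
      refine ⟨fun h => ⟨h, ?_⟩, fun h => h.1⟩
      obtain ⟨a, b, -, rfl⟩ := Finset.card_eq_two.1 h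
      have h1 (x : Char2 ι) : x + x = 0 := ZModModule.add_self x
      have h2 (x y : Char2 ι) : x + (x + y) = y := by rw [← add_assoc, h1, zero_add]
      simp [add_comm, add_left_comm, h1, h2]
  rw [← hoff, sq, Finset.sum_mul_sum, ← Finset.sum_product', ← Finset.diag_union_offDiag,
    Finset.sum_union (Finset.disjoint_diag_offDiag _), Finset.sum_diag]
  rw [Finset.sum_congr rfl fun p hp => by
    rw [Finset.prod_pair (Finset.mem_offDiag.1 hp).2.2, mul_pow]]
  simp_rw [← pow_add, ← two_mul]
  ring

/-- Ordered triples of distinct elements of a finite set. -/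
def distinctTriples {α : Type*} [DecidableEq α] (W : Finset α) : Finset (α × α × α) :=
  (W ×ˢ W ×ˢ W).filter fun t => t.1 ≠ t.2.1 ∧ t.1 ≠ t.2.2 ∧ t.2.1 ≠ t.2.2

theorem mem_distinctTriples {α : Type*} [DecidableEq α] {W : Finset α} {a b c : α} :
    (a, b, c) ∈ distinctTriples W ↔
      (a ∈ W ∧ b ∈ W ∧ c ∈ W) ∧ a ≠ b ∧ a ≠ c ∧ b ≠ c := by
  simp [distinctTriples]

theorem card_distinctTriples {α : Type*} [DecidableEq α] (W : Finset α) :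
    (distinctTriples W).card = W.card * ((W.card - 1) * (W.card - 2)) := by
  have h : distinctTriples W = W.biUnion fun a => (W.erase a).biUnion fun b =>
      ((W.erase a).erase b).image fun c => (a, b, c) := by
    ext ⟨a, b, c⟩
    simp only [mem_distinctTriples, Finset.mem_biUnion, Finset.mem_image, Finset.mem_erase,
      Prod.mk.injEq]
    aesop
  rw [h, Finset.card_biUnion]
  · rw [Finset.sum_const_nat]
    intro a ha
    rw [Finset.card_biUnion]
    · rw [← Finset.card_erase_of_mem ha, Finset.sum_const_nat]
      intro b hb
      rw [Finset.card_image_of_injective _ fun c d h => by simpa using h,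
        Finset.card_erase_of_mem hb, Finset.card_erase_of_mem ha]
      rfl
    · intro b _ b' _ hbb
      rw [Function.onFun, Finset.disjoint_left]
      aesop
  · intro a _ a' _ haa
    rw [Function.onFun, Finset.disjoint_left]
    aesop

theorem notMem_of_distinct_add_add {A : Type*} [AddCommGroup A] [Module (ZMod 2) A] [DecidableEq A]
    {a b c : A} (hab : a ≠ b) (hac : a ≠ c) (hbc : b ≠ c) :
    a ∉ ({b, c, a + b + c} : Finset A) ∧ b ∉ ({c, a + b + c} : Finset A) ∧
      c ∉ ({a + b + c} : Finset A) := by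
  have key (x y : A) (z : A) (hyz : y ≠ z) : x ≠ x + y + z := fun h => by
    rw [add_assoc, left_eq_add, char_two_add_eq_zero_iff] at h
    exact hyz h.symm
  have ha := key a b c hbc
  have hb : b ≠ a + b + c := by simpa [add_comm a b] using key b a c hac
  have hc : c ≠ a + b + c := by
    have := key c a b hab
    rwa [add_assoc, add_comm c] at this
  simp [hab, hac, hbc, ha, hb, hc]

theorem sum_distinctTriples_prod {ι : Type} [Fintype ι] [DecidableEq ι] (s : ℕ)
    (τ : Matrix ι ι ℂ) :
    ∑ t ∈ distinctTriples (Finset.univ : Finset (Char2 ι)),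
      (∏ w ∈ ({t.1, t.2.1, t.2.2, t.1 + t.2.1 + t.2.2} : Finset (Char2 ι)), thetaConst w τ) ^ s =
      24 * Sform ι 2 s τ := by
  classical
  have hcard {a b c : Char2 ι} (h : a ≠ b ∧ a ≠ c ∧ b ≠ c) :
      ({a, b, c, a + b + c} : Finset (Char2 ι)).card = 4 := by
    obtain ⟨h1, h2, h3⟩ := notMem_of_distinct_add_add h.1 h.2.1 h.2.2
    rw [Finset.card_insert_of_notMem h1, Finset.card_insert_of_notMem h2,
      Finset.card_insert_of_notMem h3, Finset.card_singleton]
  rw [Sform_eq_sum (S := Finset.univ.filter fun W : Finset (Char2 ι) => IsAffineCosetDim 2 W)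
      _ _ _ (by simp),
    Finset.mul_sum, ← Finset.sum_fiberwise_of_maps_to
      (t := Finset.univ.filter fun W : Finset (Char2 ι) => IsAffineCosetDim 2 W)
      (g := fun t => ({t.1, t.2.1, t.2.2, t.1 + t.2.1 + t.2.2} : Finset (Char2 ι)))]
  · refine Finset.sum_congr rfl fun W hW => ?_
    obtain ⟨hW4, hadd⟩ := (isAffineCosetDim_iff 2 W).1 (Finset.mem_filter.1 hW).2
    have hfib : (distinctTriples (Finset.univ : Finset (Char2 ι))).filter
        (fun t => ({t.1, t.2.1, t.2.2, t.1 + t.2.1 + t.2.2} : Finset (Char2 ι)) = W) =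
        distinctTriples W := by
      ext ⟨a, b, c⟩
      simp only [Finset.mem_filter, mem_distinctTriples, Finset.mem_univ, true_and]
      constructor
      · rintro ⟨h, rfl⟩
        exact ⟨by simp, h⟩
      · rintro ⟨⟨ha, hb, hc⟩, h⟩
        refine ⟨h, Finset.eq_of_subset_of_card_le ?_ ?_⟩
        · simp [Finset.insert_subset_iff, ha, hb, hc, hadd a ha b hb c hc]
        · rw [hW4, hcard h]
          norm_num
    rw [Finset.sum_congr rfl fun p hp => by rw [(Finset.mem_filter.1 hp).2], hfib,
      Finset.sum_const, card_distinctTriples, hW4, nsmul_eq_mul]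
    norm_num
  · rintro ⟨a, b, c⟩ ht
    have h := (mem_distinctTriples.1 ht).2
    rw [Finset.mem_filter, isAffineCosetDim_iff]
    refine ⟨Finset.mem_univ _, (hcard h).trans (by norm_num), ?_⟩
    have h1 (x : Char2 ι) : x + x = 0 := ZModModule.add_self x
    have h2 (x y : Char2 ι) : x + (x + y) = y := by rw [← add_assoc, h1, zero_add]
    simp only [Finset.mem_insert, Finset.mem_singleton]
    rintro x (rfl | rfl | rfl | rfl) y (rfl | rfl | rfl | rfl) z (rfl | rfl | rfl | rfl) <;>
      simp [add_comm, add_left_comm, h1, h2]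

theorem sum_add_add_eq_sum_distinctTriples {A : Type*} [AddCommGroup A] [Module (ZMod 2) A]
    [Fintype A] [DecidableEq A] (f : A → ℂ) :
    ∑ a, ∑ b, ∑ c, f a * f b * f c * f (a + b + c) =
      ∑ t ∈ distinctTriples (Finset.univ : Finset A),
        f t.1 * f t.2.1 * f t.2.2 * f (t.1 + t.2.1 + t.2.2) +
      3 * (∑ a, f a ^ 2) ^ 2 - 2 * ∑ a, f a ^ 4 := by
  have hsplit (a b c : A) : f a * f b * f c * f (a + b + c) =
      (if a ≠ b ∧ a ≠ c ∧ b ≠ c then f a * f b * f c * f (a + b + c) else 0) +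
      (if a = b then f a ^ 2 * f c ^ 2 else 0) + (if b = c then f a ^ 2 * f b ^ 2 else 0) +
      (if a = c then f a ^ 2 * f b ^ 2 else 0) -
      2 * (if a = b then if a = c then f a ^ 4 else 0 else 0) := by
    have hxx (x : A) : x + x = 0 := ZModModule.add_self x
    by_cases hab : a = b
    · subst hab
      by_cases hac : a = c
      · subst hac
        simp [hxx]
        ring
      · simp [hac, hxx]
        ring
    · by_cases hac : a = c
      · subst hac
        simp [hab, Ne.symm hab, add_right_comm, hxx]
        ring
      · by_cases hbc : b = c
        · subst hbc
          simp [hab, add_assoc, hxx]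
          ring
        · simp [hab, hac, hbc]
  have htriples : ∑ t ∈ distinctTriples (Finset.univ : Finset A),
      f t.1 * f t.2.1 * f t.2.2 * f (t.1 + t.2.1 + t.2.2) = ∑ a, ∑ b, ∑ c,
      if a ≠ b ∧ a ≠ c ∧ b ≠ c then f a * f b * f c * f (a + b + c) else 0 := by
    rw [distinctTriples, Finset.sum_filter, Finset.univ_product_univ, Finset.univ_product_univ,
      Fintype.sum_prod_type]
    simp_rw [Fintype.sum_prod_type]
  rw [htriples]
  rw [Finset.sum_congr rfl fun a _ => Finset.sum_congr rfl fun b _ =>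
    Finset.sum_congr rfl fun c _ => hsplit a b c]
  simp_rw [Finset.sum_sub_distrib, Finset.sum_add_distrib]
  have h1 : ∑ a, ∑ b, ∑ c, (if a = b then f a ^ 2 * f c ^ 2 else 0) = (∑ a, f a ^ 2) ^ 2 := by
    rw [sq, Finset.sum_mul_sum]
    refine Finset.sum_congr rfl fun a _ => ?_
    rw [Finset.sum_comm]
    simp
  have h2 : ∑ a, ∑ b, ∑ c, (if b = c then f a ^ 2 * f b ^ 2 else 0) = (∑ a, f a ^ 2) ^ 2 := by
    rw [sq, Finset.sum_mul_sum]
    simp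
  have h3 : ∑ a, ∑ b, ∑ c, (if a = c then f a ^ 2 * f b ^ 2 else 0) = (∑ a, f a ^ 2) ^ 2 := by
    rw [sq, Finset.sum_mul_sum]
    simp
  have h4 : ∑ a, ∑ b, ∑ c, 2 * (if a = b then if a = c then f a ^ 4 else 0 else 0) =
      2 * ∑ a, f a ^ 4 := by
    rw [Finset.mul_sum]
    refine Finset.sum_congr rfl fun a _ => ?_
    rw [Finset.sum_comm]
    simp
  rw [h1, h2, h3, h4]
  ring

/-- Igusa's identity for the modular forms `S_{i,s}^g`. -/
theorem igusa_identity_3 (g : ℕ) (hg : 2 ≤ g)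
    (τ : Matrix (Fin g) (Fin g) ℂ) (hτ : τ ∈ Siegel (Fin g)) :
    ((2 : ℂ) ^ (2 * g) - 1) * Sform (Fin g) 0 16 τ =
      6 * Sform (Fin g) 1 8 τ + 24 * Sform (Fin g) 2 4 τ := by
  have hC := sum_add_add_of_fourier_eigenvector (f := fun m => thetaConst m τ ^ 4)
    (sum_zsign_mul_thetaConst_pow_four hτ)
  have hT := sum_add_add_eq_sum_distinctTriples fun m : Char2 (Fin g) => thetaConst m τ ^ 4
  have hprod : ∑ t ∈ distinctTriples (Finset.univ : Finset (Char2 (Fin g))),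
      thetaConst t.1 τ ^ 4 * thetaConst t.2.1 τ ^ 4 * thetaConst t.2.2 τ ^ 4 *
        thetaConst (t.1 + t.2.1 + t.2.2) τ ^ 4 = 24 * Sform (Fin g) 2 4 τ := by
    rw [← sum_distinctTriples_prod]
    refine Finset.sum_congr rfl fun t ht => ?_
    obtain ⟨a, b, c⟩ := t
    obtain ⟨hab, hac, hbc⟩ := (mem_distinctTriples.1 ht).2
    obtain ⟨h1, h2, h3⟩ := notMem_of_distinct_add_add hab hac hbc
    rw [Finset.prod_insert h1, Finset.prod_insert h2, Finset.prod_insert h3,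
      Finset.prod_singleton]
    ring
  have h1 := two_mul_Sform_one (ι := Fin g) 8 τ
  have h0 := Sform_zero (ι := Fin g) 16 τ
  simp only [← pow_mul, Nat.reduceMul, Fintype.card_fin] at hC hT h1
  rw [hprod] at hT
  rw [← h0] at hC hT h1
  linear_combination hT - hC - 3 * h1
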